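/- Let (u, N, p) be a classical solution of the damped Navier–Stokes–Bardina equations with initial datum u₀ and force f. Then for all t ≥ 0: ‖u(t,·)‖²_{L²} + α²‖u(t,·)‖²_{Ḣ¹} + ∫₀ᵗ ( ν ‖u(s,·)‖²_{Ḣ¹} + να² ‖u(s,·)‖²_{Ḣ²} ) ds ≤ e^{2t} ( ‖u₀‖²_{L²} + α²‖u₀‖²_{Ḣ¹} ) + e^{2t} t ( ‖f‖²_{L²} + α²‖f‖²_{Ḣ¹} ). -/

import Mathlib

open MeasureTheory Set

noncomputable section

abbrev V3 : Type := Fin 3 → ℝ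

def pd (j : Fin 3) (g : V3 → Fin 3 → ℝ) : V3 → Fin 3 → ℝ :=
  fun x => fderiv ℝ g x (Pi.single j 1)

def pdS (j : Fin 3) (g : V3 → ℝ) : V3 → ℝ :=
  fun x => fderiv ℝ g x (Pi.single j 1)

def L2sq (g : V3 → Fin 3 → ℝ) : ℝ := ∫ x : V3, ∑ i, (g x i)^2
def H1sq (g : V3 → Fin 3 → ℝ) : ℝ := ∫ x : V3, ∑ i, ∑ j, (pd j g x i)^2
def H2sq (g : V3 → Fin 3 → ℝ) : ℝ := ∫ x : V3, ∑ i, ∑ j, ∑ k, (pd k (pd j g) x i)^2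
def H1aSq (α : ℝ) (g : V3 → Fin 3 → ℝ) : ℝ := L2sq g + α^2 * H1sq g

def IsSchwartz {F : Type*} [NormedAddCommGroup F] [NormedSpace ℝ F] (g : V3 → F) : Prop :=
  ContDiff ℝ (⊤ : ℕ∞) g ∧ ∀ (k n : ℕ), ∃ C : ℝ, ∀ x : V3, ‖x‖ ^ k * ‖iteratedFDeriv ℝ n g x‖ ≤ C

def IsForce (f : V3 → Fin 3 → ℝ) : Prop :=
  IsSchwartz f ∧ ∀ x, (∑ j, pd j f x j) = 0

def SchwartzLocBdd {F : Type*} [NormedAddCommGroup F] [NormedSpace ℝ F]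
    (g : ℝ → V3 → F) : Prop :=
  ContDiffOn ℝ (⊤ : ℕ∞) (fun q : ℝ × V3 => g q.1 q.2) (Set.Ici (0:ℝ) ×ˢ Set.univ) ∧
  ∀ T > (0:ℝ), ∀ (k n : ℕ), ∃ C : ℝ, ∀ t ∈ Set.Icc (0:ℝ) T, ∀ x : V3,
    ‖x‖ ^ k * ‖iteratedFDeriv ℝ n (g t) x‖ ≤ C

structure ClassicalSolution (α β ν : ℝ) (u₀ f : V3 → Fin 3 → ℝ) where
  u : ℝ → V3 → Fin 3 → ℝ
  N : ℝ → V3 → Fin 3 → ℝ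
  p : ℝ → V3 → ℝ
  reg_u : SchwartzLocBdd u
  reg_N : SchwartzLocBdd N
  reg_p : SchwartzLocBdd p
  divFree : ∀ t ≥ (0:ℝ), ∀ x, (∑ j, pd j (u t) x j) = 0
  filter : ∀ t ≥ (0:ℝ), ∀ x i, -α^2 * (∑ j, pd j (pd j (N t)) x i) + N t x i
      = ∑ j, u t x j * pd j (u t) x i
  momentum : ∀ t ≥ (0:ℝ), ∀ x i,
      derivWithin (fun s => u s x i) (Set.Ici (0:ℝ)) t + N t x i
        - ν * (∑ j, pd j (pd j (u t)) x i) + pdS i (p t) x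
      = f x i - β * u t x i
  init : ∀ x, u 0 x = u₀ x


open scoped SchwartzMap Topology ContDiff
open Filter

/-- The `j`-th partial derivative on scalar Schwartz functions. -/
def schwartzPd (j : Fin 3) : 𝓢(V3, ℝ) →ₗ[ℝ] 𝓢(V3, ℝ) :=
  (LineDeriv.lineDerivOpCLM ℝ 𝓢(V3, ℝ) (Pi.single j 1 : V3)).toLinearMap

lemma schwartzPd_apply (j : Fin 3) (a : 𝓢(V3, ℝ)) (x : V3) : schwartzPd j a x = pdS j a x :=
  SchwartzMap.lineDerivOp_apply_eq_fderiv (F := ℝ) _ a x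

lemma coe_schwartzPd (j : Fin 3) (a : 𝓢(V3, ℝ)) : ⇑(schwartzPd j a) = pdS j a :=
  funext (schwartzPd_apply j a)

lemma schwartzPd_comm (j k : Fin 3) (a : 𝓢(V3, ℝ)) :
    schwartzPd j (schwartzPd k a) = schwartzPd k (schwartzPd j a) := by
  have key : ∀ j k : Fin 3, ∀ x : V3, pdS j (pdS k a) x
      = fderiv ℝ (fderiv ℝ a) x (Pi.single j 1) (Pi.single k 1) := by
    intro j k x
    have h : DifferentiableAt ℝ (fderiv ℝ a) x :=
      ((a.smooth 2).fderiv_right (m := 1) (by norm_num)).differentiable (by norm_num) x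
    unfold pdS
    rw [fderiv_clm_apply h (by fun_prop)]
    simp
  ext x
  rw [schwartzPd_apply, coe_schwartzPd, schwartzPd_apply, coe_schwartzPd, key, key]
  exact ((a.smooth 2).contDiffAt.isSymmSndFDerivAt (by simp)) _ _

/-- The pointwise product of scalar Schwartz functions. -/
def schwartzMul (a b : 𝓢(V3, ℝ)) : 𝓢(V3, ℝ) :=
  SchwartzMap.pairing (ContinuousLinearMap.mul ℝ ℝ) a b

lemma schwartzMul_apply (a b : 𝓢(V3, ℝ)) (x : V3) : schwartzMul a b x = a x * b x := rfl

lemma integrable_schwartz_mul (a b : 𝓢(V3, ℝ)) : Integrable (fun x => a x * b x) :=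
  (schwartzMul a b).integrable

/-- The `L²` pairing of scalar Schwartz functions. -/
def schwartzIp : 𝓢(V3, ℝ) →ₗ[ℝ] 𝓢(V3, ℝ) →ₗ[ℝ] ℝ :=
  LinearMap.mk₂ ℝ (fun a b => ∫ x, a x * b x)
    (fun a b c => by
      rw [← integral_add (integrable_schwartz_mul _ _) (integrable_schwartz_mul _ _)]
      simp [add_mul])
    (fun r a b => by simp [mul_assoc, integral_const_mul])
    (fun a b c => by
      rw [← integral_add (integrable_schwartz_mul _ _) (integrable_schwartz_mul _ _)]
      simp [mul_add])
    (fun r a b => by simp [mul_left_comm, integral_const_mul])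

lemma schwartzIp_apply (a b : 𝓢(V3, ℝ)) : schwartzIp a b = ∫ x, a x * b x := rfl

lemma schwartzIp_comm (a b : 𝓢(V3, ℝ)) : schwartzIp a b = schwartzIp b a := by
  simp only [schwartzIp_apply, mul_comm]

lemma schwartzIp_self_nonneg (a : 𝓢(V3, ℝ)) : 0 ≤ schwartzIp a a :=
  integral_nonneg fun x => mul_self_nonneg (a x)

lemma two_mul_schwartzIp_le (a b : 𝓢(V3, ℝ)) :
    2 * schwartzIp a b ≤ schwartzIp a a + schwartzIp b b := by
  have h := schwartzIp_self_nonneg (a - b)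
  simp only [map_sub, LinearMap.sub_apply, schwartzIp_comm b a] at h
  linarith

lemma schwartzIp_pd_right (j : Fin 3) (a b : 𝓢(V3, ℝ)) :
    schwartzIp a (schwartzPd j b) = -schwartzIp (schwartzPd j a) b :=
  SchwartzMap.integral_mul_lineDerivOp_right_eq_neg_left a b _

/-- The Laplacian on scalar Schwartz functions. -/
def schwartzLap : 𝓢(V3, ℝ) →ₗ[ℝ] 𝓢(V3, ℝ) := ∑ j, schwartzPd j ∘ₗ schwartzPd j

lemma schwartzLap_eq (a : 𝓢(V3, ℝ)) : schwartzLap a = ∑ j, schwartzPd j (schwartzPd j a) := by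
  simp [schwartzLap]

lemma schwartzLap_apply (a : 𝓢(V3, ℝ)) (x : V3) :
    schwartzLap a x = ∑ j, pdS j (pdS j a) x := by
  rw [schwartzLap_eq, sum_apply]
  simp only [schwartzPd_apply, coe_schwartzPd]

lemma schwartzPd_lap (j : Fin 3) (a : 𝓢(V3, ℝ)) :
    schwartzPd j (schwartzLap a) = schwartzLap (schwartzPd j a) := by
  simp only [schwartzLap_eq, map_sum]
  exact Finset.sum_congr rfl fun k _ => by rw [schwartzPd_comm, schwartzPd_comm j k a]

lemma schwartzIp_lap (a b : 𝓢(V3, ℝ)) :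
    schwartzIp a (schwartzLap b) = -∑ j, schwartzIp (schwartzPd j a) (schwartzPd j b) := by
  simp only [schwartzLap_eq, map_sum, schwartzIp_pd_right, Finset.sum_neg_distrib]

lemma schwartzIp_lap_left (a b : 𝓢(V3, ℝ)) :
    schwartzIp (schwartzLap a) b = schwartzIp a (schwartzLap b) := by
  rw [schwartzIp_comm, schwartzIp_lap, schwartzIp_lap]
  simp only [schwartzIp_comm]

lemma schwartzIp_lap_lap (a : 𝓢(V3, ℝ)) :
    schwartzIp (schwartzLap a) (schwartzLap a)
      = ∑ j, ∑ k, schwartzIp (schwartzPd k (schwartzPd j a)) (schwartzPd k (schwartzPd j a)) := by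
  rw [schwartzIp_lap]
  rw [← Finset.sum_neg_distrib]
  refine Finset.sum_congr rfl fun j _ => ?_
  rw [schwartzPd_lap, schwartzIp_lap_left, schwartzIp_lap, neg_neg]

lemma schwartzPd_mul (j : Fin 3) (a b : 𝓢(V3, ℝ)) (x : V3) :
    schwartzPd j (schwartzMul a b) x = a x * schwartzPd j b x + schwartzPd j a x * b x := by
  simp only [schwartzPd_apply, pdS]
  rw [show (⇑(schwartzMul a b) : V3 → ℝ) = fun x => a x * b x from rfl,
    fderiv_fun_mul a.differentiableAt b.differentiableAt]
  simp [mul_comm]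

/-- The transport term of a divergence-free field is orthogonal to the transported function. -/
lemma schwartz_transport_orthogonal (U : Fin 3 → 𝓢(V3, ℝ)) (hU : ∑ j, schwartzPd j (U j) = 0)
    (a : 𝓢(V3, ℝ)) :
    schwartzIp (∑ j, schwartzMul (U j) (schwartzPd j a)) a = 0 := by
  have h1 : ∀ j, 2 * schwartzIp (schwartzMul (U j) (schwartzPd j a)) a
      = -schwartzIp (schwartzPd j (U j)) (schwartzMul a a) := by
    intro j
    rw [← schwartzIp_pd_right, schwartzIp_apply, schwartzIp_apply, ← integral_const_mul]
    refine integral_congr_ae (.of_forall fun x => ?_)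
    simp only [schwartzPd_mul, schwartzMul_apply]
    ring
  have h2 : 2 * schwartzIp (∑ j, schwartzMul (U j) (schwartzPd j a)) a
      = -schwartzIp (∑ j, schwartzPd j (U j)) (schwartzMul a a) := by
    simp only [map_sum, LinearMap.sum_apply, Finset.mul_sum, h1, Finset.sum_neg_distrib]
  rw [hU] at h2
  simpa using h2

/-- The `H¹_α` energy of a scalar Schwartz function. -/
def schwartzEnergy (α : ℝ) (a : 𝓢(V3, ℝ)) : ℝ :=
  schwartzIp a a + α ^ 2 * ∑ j, schwartzIp (schwartzPd j a) (schwartzPd j a)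

/-- The dissipation of a scalar Schwartz function. -/
def schwartzDissipation (α ν : ℝ) (a : 𝓢(V3, ℝ)) : ℝ :=
  ν * ∑ j, schwartzIp (schwartzPd j a) (schwartzPd j a)
    + ν * α ^ 2 * ∑ j, ∑ k,
      schwartzIp (schwartzPd k (schwartzPd j a)) (schwartzPd k (schwartzPd j a))

lemma schwartzEnergy_nonneg (α : ℝ) (a : 𝓢(V3, ℝ)) : 0 ≤ schwartzEnergy α a :=
  add_nonneg (schwartzIp_self_nonneg a)
    (mul_nonneg (sq_nonneg α) (Finset.sum_nonneg fun _ _ => schwartzIp_self_nonneg _))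

lemma schwartzDissipation_nonneg {ν : ℝ} (hν : 0 ≤ ν) (α : ℝ) (a : 𝓢(V3, ℝ)) :
    0 ≤ schwartzDissipation α ν a :=
  add_nonneg (mul_nonneg hν (Finset.sum_nonneg fun _ _ => schwartzIp_self_nonneg _))
    (mul_nonneg (mul_nonneg hν (sq_nonneg α))
      (Finset.sum_nonneg fun _ _ => Finset.sum_nonneg fun _ _ => schwartzIp_self_nonneg _))

lemma schwartzIp_helmholtz (α : ℝ) (a b : 𝓢(V3, ℝ)) :
    schwartzIp a (b - α ^ 2 • schwartzLap b)
      = schwartzIp a b + α ^ 2 * ∑ j, schwartzIp (schwartzPd j a) (schwartzPd j b) := by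
  simp [schwartzIp_lap]

lemma schwartzIp_helmholtz_self (α : ℝ) (a : 𝓢(V3, ℝ)) :
    schwartzIp a (a - α ^ 2 • schwartzLap a) = schwartzEnergy α a :=
  schwartzIp_helmholtz α a a

lemma two_mul_schwartzIp_helmholtz_le (α : ℝ) (a b : 𝓢(V3, ℝ)) :
    2 * schwartzIp a (b - α ^ 2 • schwartzLap b) ≤ schwartzEnergy α a + schwartzEnergy α b := by
  have h : 2 * ∑ j, schwartzIp (schwartzPd j a) (schwartzPd j b)
      ≤ ∑ j, schwartzIp (schwartzPd j a) (schwartzPd j a)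
        + ∑ j, schwartzIp (schwartzPd j b) (schwartzPd j b) := by
    rw [Finset.mul_sum, ← Finset.sum_add_distrib]
    exact Finset.sum_le_sum fun j _ => two_mul_schwartzIp_le _ _
  rw [schwartzIp_helmholtz, schwartzEnergy, schwartzEnergy]
  nlinarith [two_mul_schwartzIp_le a b, mul_le_mul_of_nonneg_left h (sq_nonneg α)]

lemma schwartzIp_lap_helmholtz (α ν : ℝ) (a : 𝓢(V3, ℝ)) :
    schwartzIp (ν • schwartzLap a) (a - α ^ 2 • schwartzLap a) = -schwartzDissipation α ν a := by
  simp only [map_sub, map_smul, LinearMap.smul_apply, smul_eq_mul, schwartzIp_lap_lap,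
    schwartzIp_lap_left a a, schwartzIp_lap a a, schwartzDissipation]
  ring

lemma schwartzIp_pressure_helmholtz (α : ℝ) (U : Fin 3 → 𝓢(V3, ℝ))
    (hU : ∑ j, schwartzPd j (U j) = 0) (P : 𝓢(V3, ℝ)) :
    ∑ i, schwartzIp (schwartzPd i P) (U i - α ^ 2 • schwartzLap (U i)) = 0 := by
  have h : ∀ i, schwartzIp (schwartzPd i P) (U i - α ^ 2 • schwartzLap (U i))
      = -schwartzIp (P - α ^ 2 • schwartzLap P) (schwartzPd i (U i)) := by
    intro i
    rw [← neg_neg (schwartzIp (schwartzPd i P) _), ← schwartzIp_pd_right]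
    simp only [map_sub, map_smul, schwartzPd_lap, LinearMap.sub_apply, LinearMap.smul_apply,
      schwartzIp_lap_left]
  simp only [h, Finset.sum_neg_distrib, ← map_sum, hU, map_zero, neg_zero]

/-- The energy inequality in differential form, for the right-hand side of the
damped Navier-Stokes-Bardina equations at a fixed time. -/
lemma schwartz_energy_rate_le {α β ν : ℝ} (hβ : 0 ≤ β) (hν : 0 ≤ ν) (U N F : Fin 3 → 𝓢(V3, ℝ))
    (P : 𝓢(V3, ℝ)) (hU : ∑ j, schwartzPd j (U j) = 0)
    (hN : ∀ i, N i - α ^ 2 • schwartzLap (N i) = ∑ j, schwartzMul (U j) (schwartzPd j (U i))) :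
    2 * ∑ i, schwartzIp (F i - β • U i - N i + ν • schwartzLap (U i) - schwartzPd i P)
        (U i - α ^ 2 • schwartzLap (U i))
      ≤ ∑ i, schwartzEnergy α (F i) + ∑ i, schwartzEnergy α (U i)
        - ∑ i, schwartzDissipation α ν (U i) := by
  have h : ∀ i, schwartzIp (F i - β • U i - N i + ν • schwartzLap (U i) - schwartzPd i P)
        (U i - α ^ 2 • schwartzLap (U i))
      = schwartzIp (F i) (U i - α ^ 2 • schwartzLap (U i)) - β * schwartzEnergy α (U i)
        - schwartzDissipation α ν (U i)
        - schwartzIp (schwartzPd i P) (U i - α ^ 2 • schwartzLap (U i)) := by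
    intro i
    have hNi : schwartzIp (N i) (U i - α ^ 2 • schwartzLap (U i)) = 0 := by
      rw [← schwartz_transport_orthogonal U hU (U i), ← hN]
      simp only [map_sub, map_smul, LinearMap.sub_apply, LinearMap.smul_apply, schwartzIp_lap_left]
    rw [← schwartzIp_helmholtz_self, map_sub schwartzIp, map_add schwartzIp, map_sub schwartzIp,
      map_sub schwartzIp, LinearMap.sub_apply,
      LinearMap.add_apply, LinearMap.sub_apply, LinearMap.sub_apply, hNi, schwartzIp_lap_helmholtz,
      map_smul schwartzIp, LinearMap.smul_apply, smul_eq_mul]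
    ring
  simp only [h, Finset.sum_sub_distrib, ← Finset.mul_sum, schwartzIp_pressure_helmholtz α U hU P]
  have hF : 2 * ∑ i, schwartzIp (F i) (U i - α ^ 2 • schwartzLap (U i))
      ≤ ∑ i, schwartzEnergy α (F i) + ∑ i, schwartzEnergy α (U i) := by
    rw [Finset.mul_sum, ← Finset.sum_add_distrib]
    exact Finset.sum_le_sum fun i _ => two_mul_schwartzIp_helmholtz_le _ _ _
  have hE : 0 ≤ ∑ i, schwartzEnergy α (U i) :=
    Finset.sum_nonneg fun i _ => schwartzEnergy_nonneg _ _
  have hD : 0 ≤ ∑ i, schwartzDissipation α ν (U i) :=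
    Finset.sum_nonneg fun i _ => schwartzDissipation_nonneg hν _ _
  nlinarith [mul_nonneg hβ hE]

section Families

variable {F G : Type*} [NormedAddCommGroup F] [NormedSpace ℝ F] [NormedAddCommGroup G]
  [NormedSpace ℝ G]

lemma SchwartzLocBdd.contDiff {g : ℝ → V3 → F} (hg : SchwartzLocBdd g) {t : ℝ} (ht : 0 ≤ t) :
    ContDiff ℝ ∞ (g t) :=
  contDiffOn_univ.1 <| hg.1.comp (f := fun x : V3 => (t, x)) (by fun_prop)
    fun _ _ => ⟨ht, mem_univ _⟩

lemma SchwartzLocBdd.contDiffOn_time {g : ℝ → V3 → F} (hg : SchwartzLocBdd g) (x : V3) :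
    ContDiffOn ℝ ∞ (fun t => g t x) (Ici 0) :=
  hg.1.comp (f := fun t : ℝ => (t, x)) (by fun_prop) fun _ ht => ⟨ht, mem_univ _⟩

/-- The time slices of a locally bounded Schwartz family, as Schwartz maps. -/
def SchwartzLocBdd.slice {g : ℝ → V3 → F} (hg : SchwartzLocBdd g) {t : ℝ} (ht : 0 ≤ t) :
    𝓢(V3, F) where
  toFun := g t
  smooth' := hg.contDiff ht
  decay' k n := (hg.2 (t + 1) (by positivity) k n).imp fun _ h => h t ⟨ht, by linarith⟩

lemma SchwartzLocBdd.coe_slice {g : ℝ → V3 → F} (hg : SchwartzLocBdd g) {t : ℝ} (ht : 0 ≤ t) :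
    ⇑(hg.slice ht) = g t := rfl

lemma IsSchwartz.schwartzLocBdd {g : V3 → F} (hg : IsSchwartz g) :
    SchwartzLocBdd fun _ => g :=
  ⟨(hg.1.comp contDiff_snd).contDiffOn, fun _ _ k n => (hg.2 k n).imp fun _ h _ _ => h⟩

lemma SchwartzLocBdd.clm {g : ℝ → V3 → F} (hg : SchwartzLocBdd g) (L : F →L[ℝ] G) :
    SchwartzLocBdd fun t x => L (g t x) := by
  refine ⟨L.contDiff.comp_contDiffOn hg.1, fun T hT k n => ?_⟩
  obtain ⟨C, hC⟩ := hg.2 T hT k n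
  refine ⟨‖L‖ * C, fun t ht x => ?_⟩
  have h := L.norm_iteratedFDeriv_comp_left (hg.contDiff ht.1).contDiffAt (x := x)
    (n := n) (by exact_mod_cast le_top)
  calc ‖x‖ ^ k * ‖iteratedFDeriv ℝ n (fun x => L (g t x)) x‖
      ≤ ‖x‖ ^ k * (‖L‖ * ‖iteratedFDeriv ℝ n (g t) x‖) := by gcongr; exact h
    _ = ‖L‖ * (‖x‖ ^ k * ‖iteratedFDeriv ℝ n (g t) x‖) := by ring
    _ ≤ ‖L‖ * C := by gcongr; exact hC t ht x

lemma SchwartzLocBdd.const_smul {g : ℝ → V3 → F} (hg : SchwartzLocBdd g) (c : ℝ) :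
    SchwartzLocBdd fun t x => c • g t x :=
  hg.clm (c • ContinuousLinearMap.id ℝ F)

lemma SchwartzLocBdd.add {g h : ℝ → V3 → F} (hg : SchwartzLocBdd g) (hh : SchwartzLocBdd h) :
    SchwartzLocBdd fun t x => g t x + h t x := by
  refine ⟨hg.1.add hh.1, fun T hT k n => ?_⟩
  obtain ⟨C, hC⟩ := hg.2 T hT k n
  obtain ⟨D, hD⟩ := hh.2 T hT k n
  refine ⟨C + D, fun t ht x => ?_⟩
  rw [fun_iteratedFDeriv_add_apply ((hg.contDiff ht.1).of_le (by exact_mod_cast le_top)).contDiffAt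
    ((hh.contDiff ht.1).of_le (by exact_mod_cast le_top)).contDiffAt]
  calc _ ≤ ‖x‖ ^ k * (‖iteratedFDeriv ℝ n (g t) x‖ + ‖iteratedFDeriv ℝ n (h t) x‖) := by
        gcongr; exact norm_add_le _ _
    _ ≤ C + D := by rw [mul_add]; exact add_le_add (hC t ht x) (hD t ht x)

lemma SchwartzLocBdd.sub {g h : ℝ → V3 → F} (hg : SchwartzLocBdd g) (hh : SchwartzLocBdd h) :
    SchwartzLocBdd fun t x => g t x - h t x := by
  simpa [sub_eq_add_neg] using hg.add (hh.const_smul (-1))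

lemma SchwartzLocBdd.sum_fin_three {g : Fin 3 → ℝ → V3 → F} (hg : ∀ i, SchwartzLocBdd (g i)) :
    SchwartzLocBdd fun t x => ∑ i, g i t x := by
  simpa only [Fin.sum_univ_three] using ((hg 0).add (hg 1)).add (hg 2)

lemma SchwartzLocBdd.apply {g : ℝ → V3 → Fin 3 → ℝ} (hg : SchwartzLocBdd g) (i : Fin 3) :
    SchwartzLocBdd fun t x => g t x i :=
  hg.clm (ContinuousLinearMap.proj (R := ℝ) (φ := fun _ : Fin 3 => ℝ) i)

lemma SchwartzLocBdd.fderiv {g : ℝ → V3 → F} (hg : SchwartzLocBdd g) :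
    SchwartzLocBdd fun t => fderiv ℝ (g t) := by
  have hS : UniqueDiffOn ℝ (Ici (0 : ℝ) ×ˢ (univ : Set V3)) :=
    (uniqueDiffOn_Ici 0).prod uniqueDiffOn_univ
  constructor
  · have h1 := (hg.1.fderivWithin (m := ∞) hS (by simp)).clm_comp
      (contDiffOn_const (c := ContinuousLinearMap.inr ℝ ℝ V3))
    refine h1.congr fun q hq => ?_
    have hd : HasFDerivWithinAt (fun q : ℝ × V3 => g q.1 q.2)
        (fderivWithin ℝ (fun q : ℝ × V3 => g q.1 q.2) (Ici (0 : ℝ) ×ˢ univ) q)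
        (Ici (0 : ℝ) ×ˢ univ) (q.1, q.2) :=
      (hg.1.differentiableOn (by simp) q hq).hasFDerivWithinAt
    have hc := hd.comp (s := univ) q.2 (hasFDerivAt_prodMk_right q.1 q.2).hasFDerivWithinAt
      fun _ _ => ⟨hq.1, mem_univ _⟩
    exact (hasFDerivWithinAt_univ.1 hc).fderiv
  · intro T hT k n
    obtain ⟨C, hC⟩ := hg.2 T hT k (n + 1)
    refine ⟨C, fun t ht x => ?_⟩
    rw [norm_iteratedFDeriv_fderiv]
    exact hC t ht x

lemma SchwartzLocBdd.partialDeriv {g : ℝ → V3 → ℝ} (hg : SchwartzLocBdd g) (j : Fin 3) :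
    SchwartzLocBdd fun t => pdS j (g t) :=
  hg.fderiv.clm (ContinuousLinearMap.apply ℝ ℝ (Pi.single j 1 : V3))

lemma SchwartzLocBdd.continuousWithinAt {g : ℝ → V3 → F} (hg : SchwartzLocBdd g) (x : V3) {t : ℝ}
    (ht : 0 ≤ t) : ContinuousWithinAt (fun s => g s x) (Ici 0) t :=
  (hg.contDiffOn_time x).continuousOn t ht

lemma SchwartzLocBdd.exists_bound {g : ℝ → V3 → F} (hg : SchwartzLocBdd g) {T : ℝ} (hT : 0 < T) :
    ∃ C, ∀ t ∈ Icc 0 T, ∀ x, ‖g t x‖ ≤ C := by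
  obtain ⟨C, hC⟩ := hg.2 T hT 0 0
  exact ⟨C, fun t ht x => by simpa using hC t ht x⟩

lemma SchwartzLocBdd.exists_integrable_bound {g : ℝ → V3 → F} (hg : SchwartzLocBdd g) {T : ℝ}
    (hT : 0 < T) :
    ∃ b : V3 → ℝ, Integrable b ∧ ∀ t ∈ Icc 0 T, ∀ x, ‖g t x‖ ≤ b x := by
  obtain ⟨C, hC⟩ := hg.2 T hT 0 0
  obtain ⟨D, hD⟩ := hg.2 T hT 4 0
  refine ⟨fun x => 8 * (C + D) * (1 + ‖x‖) ^ (-(4 : ℝ)),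
    (integrable_one_add_norm (by simp; norm_num)).const_mul _, fun t ht x => ?_⟩
  have h0 := hC t ht x
  have h4 := hD t ht x
  simp only [norm_iteratedFDeriv_zero, pow_zero, one_mul] at h0 h4
  have hx := norm_nonneg x
  beta_reduce
  rw [Real.rpow_neg (by positivity), ← div_eq_mul_inv, le_div_iff₀ (by positivity)]
  norm_cast
  have hp : (1 + ‖x‖) ^ 4 ≤ 8 * (1 + ‖x‖ ^ 4) := by
    nlinarith [sq_nonneg (‖x‖ - 1), sq_nonneg (‖x‖ ^ 2 - 1), sq_nonneg (‖x‖ ^ 2 - ‖x‖),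
      mul_nonneg hx (sq_nonneg (‖x‖ - 1))]
  calc ‖g t x‖ * (1 + ‖x‖) ^ 4 ≤ ‖g t x‖ * (8 * (1 + ‖x‖ ^ 4)) := by gcongr
    _ = 8 * (‖g t x‖ + ‖x‖ ^ 4 * ‖g t x‖) := by ring
    _ ≤ 8 * (C + D) := by gcongr

lemma eventually_mem_Icc_add_one (t : ℝ) : ∀ᶠ s in 𝓝[Ici 0] t, s ∈ Icc 0 (t + 1) := by
  filter_upwards [self_mem_nhdsWithin,
    mem_nhdsWithin_of_mem_nhds (Iic_mem_nhds (lt_add_one t))] with s hs hs' using ⟨hs, hs'⟩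

lemma SchwartzLocBdd.continuousOn_integral_mul {g h : ℝ → V3 → ℝ} (hg : SchwartzLocBdd g)
    (hh : SchwartzLocBdd h) : ContinuousOn (fun t => ∫ x, g t x * h t x) (Ici 0) := by
  intro t ht
  have hT : 0 < t + 1 := add_pos_of_nonneg_of_pos ht one_pos
  obtain ⟨C, hC⟩ := hg.exists_bound hT
  obtain ⟨b, hb, hbd⟩ := hh.exists_integrable_bound hT
  have hC0 : 0 ≤ C := (norm_nonneg _).trans (hC t ⟨ht, by linarith⟩ 0)
  refine continuousWithinAt_of_dominated (bound := fun x => C * b x) ?_ ?_ (hb.const_mul C) ?_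
  · filter_upwards [self_mem_nhdsWithin] with s hs
    exact ((hg.contDiff hs).continuous.mul (hh.contDiff hs).continuous).aestronglyMeasurable
  · filter_upwards [eventually_mem_Icc_add_one t] with s hs
    refine .of_forall fun x => ?_
    rw [norm_mul]
    exact mul_le_mul (hC s hs x) (hbd s hs x) (norm_nonneg _) hC0
  · exact .of_forall fun x => (hg.continuousWithinAt x ht).mul (hh.continuousWithinAt x ht)

/-- Differentiation under the integral sign for symmetric difference quotients. -/
lemma SchwartzLocBdd.tendsto_integral_slope_mul {g g' w : ℝ → V3 → ℝ} (hg : SchwartzLocBdd g)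
    (hg' : SchwartzLocBdd g') (hw : SchwartzLocBdd w)
    (hd : ∀ t, 0 ≤ t → ∀ x, HasDerivWithinAt (fun s => g s x) (g' t x) (Ici 0) t) {t : ℝ}
    (ht : 0 ≤ t) :
    Tendsto (fun s => ∫ x, slope (fun r => g r x) t s * (w s x + w t x)) (𝓝[Ici 0 \ {t}] t)
      (𝓝 (∫ x, g' t x * (w t x + w t x))) := by
  have hT : 0 < t + 1 := add_pos_of_nonneg_of_pos ht one_pos
  have hle : 𝓝[Ici 0 \ {t}] t ≤ 𝓝[Ici 0] t := nhdsWithin_mono _ sdiff_subset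
  obtain ⟨C, hC⟩ := hg'.exists_bound hT
  obtain ⟨b, hb, hbd⟩ := hw.exists_integrable_bound hT
  have htT : t ∈ Icc 0 (t + 1) := ⟨ht, by linarith⟩
  have hC0 : 0 ≤ C := (norm_nonneg _).trans (hC t htT 0)
  refine tendsto_integral_filter_of_dominated_convergence (fun x => C * (b x + b x)) ?_ ?_
    ((hb.add hb).const_mul C) ?_
  · filter_upwards [self_mem_nhdsWithin] with s hs
    have h1 := (hg.contDiff hs.1).continuous
    have h2 := (hg.contDiff ht).continuous
    have h3 := (hw.contDiff hs.1).continuous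
    have h4 := (hw.contDiff ht).continuous
    simp only [slope_def_field]
    exact (((h1.sub h2).div_const _).mul (h3.add h4)).aestronglyMeasurable
  · filter_upwards [self_mem_nhdsWithin, hle (eventually_mem_Icc_add_one t)] with s hs hsT
    refine .of_forall fun x => ?_
    rw [norm_mul]
    refine mul_le_mul ?_ ((norm_add_le _ _).trans (add_le_add (hbd s hsT x) (hbd t htT x)))
      (norm_nonneg _) hC0
    have hm := (convex_Icc 0 (t + 1)).norm_image_sub_le_of_norm_hasDerivWithin_le
      (fun r hr => (hd r hr.1 x).mono Icc_subset_Ici_self) (fun r hr => hC r hr x) htT hsT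
    rw [slope_def_field, norm_div]
    exact div_le_of_le_mul₀ (norm_nonneg _) hC0 hm
  · refine .of_forall fun x => ?_
    exact (hasDerivWithinAt_iff_tendsto_slope.1 (hd t ht x)).mul
      (((hw.continuousWithinAt x ht).mono_left hle).add_const _)

end Families

/-- The `H¹_α` energy of a scalar function. -/
def scalarEnergy (α : ℝ) (a : V3 → ℝ) : ℝ :=
  (∫ x, a x * a x) + α ^ 2 * ∑ j, ∫ x, pdS j a x * pdS j a x

/-- The dissipation of a scalar function. -/
def scalarDissipation (α ν : ℝ) (a : V3 → ℝ) : ℝ :=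
  (ν * ∑ j, ∫ x, pdS j a x * pdS j a x)
    + ν * α ^ 2 * ∑ j, ∑ k, ∫ x, pdS k (pdS j a) x * pdS k (pdS j a) x

lemma schwartzEnergy_eq (α : ℝ) (a : 𝓢(V3, ℝ)) : schwartzEnergy α a = scalarEnergy α a := by
  simp only [schwartzEnergy, scalarEnergy, schwartzIp_apply, coe_schwartzPd]

lemma schwartzDissipation_eq (α ν : ℝ) (a : 𝓢(V3, ℝ)) :
    schwartzDissipation α ν a = scalarDissipation α ν a := by
  simp only [schwartzDissipation, scalarDissipation, schwartzIp_apply, coe_schwartzPd]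

lemma schwartzEnergy_sub (α : ℝ) (a b : 𝓢(V3, ℝ)) :
    schwartzEnergy α a - schwartzEnergy α b
      = schwartzIp (a - b) ((a - α ^ 2 • schwartzLap a) + (b - α ^ 2 • schwartzLap b)) := by
  simp only [← schwartzIp_helmholtz_self, map_sub, map_add, map_smul, LinearMap.sub_apply,
    schwartzIp_comm b a, ← schwartzIp_lap_left b a, schwartzIp_comm (schwartzLap b) a]
  ring

lemma SchwartzLocBdd.helmholtz {g : ℝ → V3 → ℝ} (hg : SchwartzLocBdd g) (α : ℝ) :
    SchwartzLocBdd fun t x => g t x - α ^ 2 * ∑ j, pdS j (pdS j (g t)) x :=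
  hg.sub ((sum_fin_three fun j => (hg.partialDeriv j).partialDeriv j).const_smul (α ^ 2))

lemma SchwartzLocBdd.hasDerivWithinAt_scalarEnergy {g g' : ℝ → V3 → ℝ} (hg : SchwartzLocBdd g)
    (hg' : SchwartzLocBdd g')
    (hd : ∀ t, 0 ≤ t → ∀ x, HasDerivWithinAt (fun s => g s x) (g' t x) (Ici 0) t) (α : ℝ) {t : ℝ}
    (ht : 0 ≤ t) :
    HasDerivWithinAt (fun s => scalarEnergy α (g s))
      (2 * schwartzIp (hg'.slice ht) (hg.slice ht - α ^ 2 • schwartzLap (hg.slice ht)))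
      (Ici 0) t := by
  rw [hasDerivWithinAt_iff_tendsto_slope]
  have hw : ∀ s (hs : 0 ≤ s) x, (hg.slice hs - α ^ 2 • schwartzLap (hg.slice hs)) x
      = g s x - α ^ 2 * ∑ j, pdS j (pdS j (g s)) x := by
    intro s hs x
    rw [sub_apply, smul_apply, schwartzLap_apply, hg.coe_slice hs,
      smul_eq_mul]
  have h := hg.tendsto_integral_slope_mul hg' (hg.helmholtz α) hd ht
  convert h.congr' ?_ using 2
  · rw [schwartzIp_apply, ← integral_const_mul]
    refine integral_congr_ae (.of_forall fun x => ?_)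
    simp only [hw, SchwartzLocBdd.coe_slice]
    ring
  · filter_upwards [self_mem_nhdsWithin] with s hs
    have hs0 : 0 ≤ s := hs.1
    rw [slope_def_field, ← hg.coe_slice hs0, ← hg.coe_slice ht, ← schwartzEnergy_eq,
      ← schwartzEnergy_eq, schwartzEnergy_sub, schwartzIp_apply, ← integral_div]
    refine integral_congr_ae (.of_forall fun x => ?_)
    simp only [slope_def_field, add_apply, hw, sub_apply,
      SchwartzLocBdd.coe_slice]
    ring

lemma SchwartzLocBdd.continuousOn_scalarDissipation {g : ℝ → V3 → ℝ} (hg : SchwartzLocBdd g)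
    (α ν : ℝ) : ContinuousOn (fun s => scalarDissipation α ν (g s)) (Ici 0) := by
  refine .add (.mul continuousOn_const (continuousOn_finsetSum _ fun j _ => ?_))
    (.mul continuousOn_const (continuousOn_finsetSum _ fun j _ =>
      continuousOn_finsetSum _ fun k _ => ?_))
  · exact (hg.partialDeriv j).continuousOn_integral_mul (hg.partialDeriv j)
  · exact ((hg.partialDeriv j).partialDeriv k).continuousOn_integral_mul
      ((hg.partialDeriv j).partialDeriv k)

lemma pd_schwartz (j : Fin 3) (A : Fin 3 → 𝓢(V3, ℝ)) :
    pd j (fun x i => A i x) = fun x i => schwartzPd j (A i) x := by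
  funext x i
  rw [schwartzPd_apply, pd, pdS, fderiv_pi fun i => SchwartzMap.differentiableAt (A i)]
  rfl

lemma L2sq_schwartz (A : Fin 3 → 𝓢(V3, ℝ)) :
    L2sq (fun x i => A i x) = ∑ i, schwartzIp (A i) (A i) := by
  simp only [L2sq, sq, schwartzIp_apply]
  exact integral_finsetSum _ fun i _ => integrable_schwartz_mul _ _

lemma H1sq_schwartz (A : Fin 3 → 𝓢(V3, ℝ)) :
    H1sq (fun x i => A i x) = ∑ i, ∑ j, schwartzIp (schwartzPd j (A i)) (schwartzPd j (A i)) := by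
  simp only [H1sq, pd_schwartz, sq, schwartzIp_apply]
  rw [integral_finsetSum _ fun i _ => integrable_finsetSum _ fun j _ => integrable_schwartz_mul _ _]
  exact Finset.sum_congr rfl fun i _ =>
    integral_finsetSum _ fun j _ => integrable_schwartz_mul _ _

lemma H2sq_schwartz (A : Fin 3 → 𝓢(V3, ℝ)) :
    H2sq (fun x i => A i x) = ∑ i, ∑ j, ∑ k,
      schwartzIp (schwartzPd k (schwartzPd j (A i))) (schwartzPd k (schwartzPd j (A i))) := by
  simp only [H2sq, pd_schwartz, sq, schwartzIp_apply]
  rw [integral_finsetSum _ fun i _ => integrable_finsetSum _ fun j _ =>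
    integrable_finsetSum _ fun k _ => integrable_schwartz_mul _ _]
  refine Finset.sum_congr rfl fun i _ => ?_
  rw [integral_finsetSum _ fun j _ => integrable_finsetSum _ fun k _ => integrable_schwartz_mul _ _]
  exact Finset.sum_congr rfl fun j _ =>
    integral_finsetSum _ fun k _ => integrable_schwartz_mul _ _

lemma energy_schwartz (α : ℝ) (A : Fin 3 → 𝓢(V3, ℝ)) :
    L2sq (fun x i => A i x) + α ^ 2 * H1sq (fun x i => A i x) = ∑ i, schwartzEnergy α (A i) := by
  simp only [L2sq_schwartz, H1sq_schwartz, schwartzEnergy, Finset.sum_add_distrib, Finset.mul_sum]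

lemma dissipation_schwartz (α ν : ℝ) (A : Fin 3 → 𝓢(V3, ℝ)) :
    ν * H1sq (fun x i => A i x) + ν * α ^ 2 * H2sq (fun x i => A i x)
      = ∑ i, schwartzDissipation α ν (A i) := by
  simp only [H1sq_schwartz, H2sq_schwartz, schwartzDissipation, Finset.sum_add_distrib,
    Finset.mul_sum]

lemma SchwartzLocBdd.energy_eq {g : ℝ → V3 → Fin 3 → ℝ} (hg : SchwartzLocBdd g) (α : ℝ) {t : ℝ}
    (ht : 0 ≤ t) :
    L2sq (g t) + α ^ 2 * H1sq (g t) = ∑ i, scalarEnergy α fun x => g t x i :=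
  (energy_schwartz α fun i => (hg.apply i).slice ht).trans <|
    Finset.sum_congr rfl fun i _ => schwartzEnergy_eq α ((hg.apply i).slice ht)

lemma SchwartzLocBdd.dissipation_eq {g : ℝ → V3 → Fin 3 → ℝ} (hg : SchwartzLocBdd g) (α ν : ℝ)
    {t : ℝ} (ht : 0 ≤ t) :
    ν * H1sq (g t) + ν * α ^ 2 * H2sq (g t) = ∑ i, scalarDissipation α ν fun x => g t x i :=
  (dissipation_schwartz α ν fun i => (hg.apply i).slice ht).trans <|
    Finset.sum_congr rfl fun i _ => schwartzDissipation_eq α ν ((hg.apply i).slice ht)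

lemma SchwartzLocBdd.pd_eq {g : ℝ → V3 → Fin 3 → ℝ} (hg : SchwartzLocBdd g) {t : ℝ} (ht : 0 ≤ t)
    (j : Fin 3) : pd j (g t) = fun x i => schwartzPd j ((hg.apply i).slice ht) x :=
  pd_schwartz j fun i => (hg.apply i).slice ht

lemma SchwartzLocBdd.sum_pd_pd_eq {g : ℝ → V3 → Fin 3 → ℝ} (hg : SchwartzLocBdd g) {t : ℝ}
    (ht : 0 ≤ t) (x : V3) (i : Fin 3) :
    ∑ j, pd j (pd j (g t)) x i = schwartzLap ((hg.apply i).slice ht) x := by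
  simp only [hg.pd_eq ht, schwartzLap_eq, sum_apply]
  exact Finset.sum_congr rfl fun j _ => congrFun (congrFun (pd_schwartz j _) x) i

lemma SchwartzLocBdd.sum_scalarEnergy_nonneg {g : ℝ → V3 → Fin 3 → ℝ} (hg : SchwartzLocBdd g)
    (α : ℝ) {t : ℝ} (ht : 0 ≤ t) : 0 ≤ ∑ i, scalarEnergy α fun x => g t x i :=
  Finset.sum_nonneg fun i _ =>
    (schwartzEnergy_nonneg α _).trans_eq (schwartzEnergy_eq α ((hg.apply i).slice ht))

lemma SchwartzLocBdd.sum_scalarDissipation_nonneg {g : ℝ → V3 → Fin 3 → ℝ}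
    (hg : SchwartzLocBdd g) (α : ℝ) {ν : ℝ} (hν : 0 ≤ ν) {t : ℝ} (ht : 0 ≤ t) :
    0 ≤ ∑ i, scalarDissipation α ν fun x => g t x i :=
  Finset.sum_nonneg fun i _ => (schwartzDissipation_nonneg hν α _).trans_eq
    (schwartzDissipation_eq α ν ((hg.apply i).slice ht))

/-- An integrated Grönwall inequality with a nonnegative continuous dissipation term. -/
lemma energy_add_integral_le {E D : ℝ → ℝ} {c t : ℝ} (ht : 0 ≤ t) (hc : 0 ≤ c)
    (hE0 : 0 ≤ E 0) (hD : ContinuousOn D (Ici 0)) (hD0 : ∀ s, 0 ≤ s → 0 ≤ D s)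
    (hE : ∀ s, 0 ≤ s → ∃ e, HasDerivWithinAt E e (Ici 0) s ∧ e ≤ c + E s - D s) :
    E t + ∫ s in (0 : ℝ)..t, D s ≤ Real.exp (2 * t) * E 0 + Real.exp (2 * t) * t * c := by
  choose! E' hE hle using hE
  have hDc : Continuous fun s => D (max s 0) :=
    hD.comp_continuous (by fun_prop) fun s => le_max_right s 0
  have hY : ∀ s, 0 ≤ s → HasDerivWithinAt (fun r => E r + ∫ q in (0 : ℝ)..r, D (max q 0))
      (E' s + D s) (Ici 0) s := by
    intro s hs
    have h := (hDc.integral_hasStrictDerivAt 0 s).hasDerivAt.hasDerivWithinAt (s := Ici 0)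
    rw [max_eq_left hs] at h
    exact (hE s hs).add h
  have hI : ∀ s, 0 ≤ s → 0 ≤ ∫ q in (0 : ℝ)..s, D (max q 0) := fun s hs =>
    intervalIntegral.integral_nonneg hs fun q _ => hD0 _ (le_max_right q 0)
  have hG := le_gronwallBound_of_liminf_deriv_right_le (f' := fun s => E' s + D s) (δ := E 0)
    (K := 1) (ε := c) (a := 0) (b := t)
    (fun s hs => ((hY s hs.1).mono Icc_subset_Ici_self).continuousWithinAt)
    (fun s hs r hr => by
      have h := ((hY s hs.1).mono (Ici_subset_Ici.2 hs.1)).liminf_right_slope_le hr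
      simpa [slope_def_field, div_eq_inv_mul] using h)
    (by simp) (fun s hs => by linarith [hle s hs.1, hI s hs.1]) t ⟨ht, le_rfl⟩
  have hcongr : ∫ s in (0 : ℝ)..t, D s = ∫ s in (0 : ℝ)..t, D (max s 0) := by
    refine intervalIntegral.integral_congr fun s hs => ?_
    rw [uIcc_of_le ht] at hs
    simp only [max_eq_left hs.1]
  rw [gronwallBound_of_K_ne_0 one_ne_zero] at hG
  simp only [one_mul, div_one, sub_zero] at hG
  rw [hcongr]
  have h1 : Real.exp t ≤ Real.exp (2 * t) := Real.exp_le_exp.2 (by linarith)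
  have h2 : Real.exp t - 1 ≤ Real.exp t * t := by
    have h := mul_le_mul_of_nonneg_left (Real.one_sub_le_exp_neg t) (Real.exp_pos t).le
    rw [← Real.exp_add, add_neg_cancel, Real.exp_zero] at h
    linarith
  have h3 : Real.exp t - 1 ≤ Real.exp (2 * t) * t :=
    h2.trans (mul_le_mul_of_nonneg_right h1 ht)
  nlinarith [mul_le_mul_of_nonneg_left h1 hE0, mul_le_mul_of_nonneg_left h3 hc]

/-- The energy of a classical solution satisfies the differential energy inequality. -/
lemma ClassicalSolution.exists_hasDerivWithinAt_energy_le {α β ν : ℝ} (hβ : 0 ≤ β) (hν : 0 ≤ ν)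
    {u₀ f : V3 → Fin 3 → ℝ} (hf : IsForce f) (sol : ClassicalSolution α β ν u₀ f) {s : ℝ}
    (hs : 0 ≤ s) :
    ∃ e, HasDerivWithinAt (fun r => ∑ i, scalarEnergy α fun x => sol.u r x i) e (Ici 0) s ∧
      e ≤ ∑ i, scalarEnergy α (fun x => f x i) + ∑ i, scalarEnergy α (fun x => sol.u s x i)
        - ∑ i, scalarDissipation α ν (fun x => sol.u s x i) := by
  have hU := fun i => sol.reg_u.apply i
  have hN := fun i => sol.reg_N.apply i
  have hF := fun i => hf.1.schwartzLocBdd.apply i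
  have hlap : ∀ i, SchwartzLocBdd fun s x => ν • ∑ j, pdS j (pdS j fun y => sol.u s y i) x :=
    fun i => (SchwartzLocBdd.sum_fin_three fun j =>
      ((hU i).partialDeriv j).partialDeriv j).const_smul ν
  have hG := fun i => ((((hF i).sub ((hU i).const_smul β)).sub (hN i)).add (hlap i)).sub
    (sol.reg_p.partialDeriv i)
  have hd : ∀ i s, 0 ≤ s → ∀ x, HasDerivWithinAt (fun r => sol.u r x i)
      (f x i - β • sol.u s x i - sol.N s x i + ν • ∑ j, pdS j (pdS j fun y => sol.u s y i) x
        - pdS i (sol.p s) x) (Ici 0) s := by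
    intro i s hs x
    have h := (((hU i).contDiffOn_time x).differentiableOn (by simp) s hs).hasDerivWithinAt
    have hm := sol.momentum s hs x i
    rw [sol.reg_u.sum_pd_pd_eq hs, schwartzLap_apply, SchwartzLocBdd.coe_slice] at hm
    refine h.congr_deriv ?_
    simp only [smul_eq_mul]
    linarith
  have hdiv : ∑ j, schwartzPd j ((hU j).slice hs) = 0 := by
    ext x
    have h := sol.divFree s hs x
    simp only [sol.reg_u.pd_eq hs] at h
    simpa only [sum_apply, zero_apply] using h
  have hfilter : ∀ i, (hN i).slice hs - α ^ 2 • schwartzLap ((hN i).slice hs)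
        = ∑ j, schwartzMul ((hU j).slice hs) (schwartzPd j ((hU i).slice hs)) := by
    intro i
    ext x
    have h := sol.filter s hs x i
    rw [sol.reg_N.sum_pd_pd_eq hs] at h
    simp only [sol.reg_u.pd_eq hs] at h
    simp only [sum_apply, schwartzMul_apply, sub_apply, smul_apply, SchwartzLocBdd.coe_slice,
      smul_eq_mul]
    linarith
  refine ⟨_, HasDerivWithinAt.fun_sum fun i _ =>
    (hU i).hasDerivWithinAt_scalarEnergy (hG i) (hd i) α hs, ?_⟩
  have h := schwartz_energy_rate_le (α := α) hβ hν (fun i => (hU i).slice hs)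
    (fun i => (hN i).slice hs) (fun i => (hF i).slice hs) (sol.reg_p.slice hs) hdiv hfilter
  simp only [schwartzEnergy_eq, schwartzDissipation_eq] at h
  have hslice : ∀ i, (hG i).slice hs = (hF i).slice hs - β • (hU i).slice hs - (hN i).slice hs
      + ν • schwartzLap ((hU i).slice hs) - schwartzPd i (sol.reg_p.slice hs) := by
    intro i
    ext x
    simp only [sub_apply, add_apply, smul_apply, schwartzLap_apply, schwartzPd_apply,
      SchwartzLocBdd.coe_slice]
  rw [← Finset.mul_sum]
  simp only [hslice]
  exact h

/-- Rough (exponentially growing) control in time of the energy of classical solutions. -/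
theorem rough_energy_control (α β ν : ℝ) (hα : 0 < α) (hβ : 0 < β) (hν : 0 < ν)
    (u₀ f : V3 → Fin 3 → ℝ) (hf : IsForce f)
    (sol : ClassicalSolution α β ν u₀ f) (t : ℝ) (ht : 0 ≤ t) :
    L2sq (sol.u t) + α^2 * H1sq (sol.u t)
      + (∫ s in (0:ℝ)..t, (ν * H1sq (sol.u s) + ν * α^2 * H2sq (sol.u s)))
    ≤ Real.exp (2*t) * (L2sq u₀ + α^2 * H1sq u₀)
      + Real.exp (2*t) * t * (L2sq f + α^2 * H1sq f) := by
  have hu₀ : sol.u 0 = u₀ := funext sol.init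
  have hD : ∫ s in (0 : ℝ)..t, (ν * H1sq (sol.u s) + ν * α ^ 2 * H2sq (sol.u s))
      = ∫ s in (0 : ℝ)..t, ∑ i, scalarDissipation α ν fun x => sol.u s x i := by
    refine intervalIntegral.integral_congr fun s hs => ?_
    rw [uIcc_of_le ht] at hs
    exact sol.reg_u.dissipation_eq α ν hs.1
  have hE₀ : L2sq u₀ + α ^ 2 * H1sq u₀ = ∑ i, scalarEnergy α fun x => sol.u 0 x i :=
    (congrArg (fun g => L2sq g + α ^ 2 * H1sq g) hu₀).symm.trans (sol.reg_u.energy_eq α le_rfl)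
  rw [hD, hE₀, sol.reg_u.energy_eq α ht,
    hf.1.schwartzLocBdd.energy_eq α le_rfl]
  exact energy_add_integral_le ht (hf.1.schwartzLocBdd.sum_scalarEnergy_nonneg α le_rfl)
    (sol.reg_u.sum_scalarEnergy_nonneg α le_rfl)
    (continuousOn_finsetSum _ fun i _ => (sol.reg_u.apply i).continuousOn_scalarDissipation α ν)
    (fun _ hs => sol.reg_u.sum_scalarDissipation_nonneg α hν.le hs)
    (fun _ hs => sol.exists_hasDerivWithinAt_energy_le hβ.le hν.le hf hs)

end
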